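/- If grade_U Ext^{i+1}_Λ(M,U) ≥ i for every M in mod Λ and every 1 ≤ i ≤ k−1, then every k-syzygy module in mod Λ is a U-k-syzygy module, i.e. lies in Ω^k_U(mod Λ). -/

import Mathlib

/-! Common definitions: concrete Ext groups (via the canonical free resolution) of a module
over a ring `R` with coefficients in an `(R,S)`-bimodule `U`, carrying their natural
`S`-module structure; grades, Gorenstein conditions, resolution dimensions, etc. -/

noncomputable section

namespace GorPaper

section Ext

variable (R : Type) [Ring R]

/-- The canonical free cover `R^(M) → M` of a module. -/
def cover (M : Type) [AddCommGroup M] [Module R M] : (M →₀ R) →ₗ[R] M :=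
  Finsupp.linearCombination R (_root_.id : M → M)

/-- The syzygy modules of `M` along its canonical free resolution:
`syz R M 0 = M` and `syz R M (n+1) = ker (R^(syz R M n) → syz R M n)`. -/
def syz (M : ModuleCat.{0} R) : ℕ → ModuleCat.{0} R
  | 0 => M
  | n + 1 => ModuleCat.of R (LinearMap.ker (cover R (syz M n)))

variable {R} in
/-- Functoriality of the free cover. -/
def freeMap {M N : Type} [AddCommGroup M] [Module R M] [AddCommGroup N] [Module R N]
    (f : M →ₗ[R] N) : (M →₀ R) →ₗ[R] (N →₀ R) :=
  Finsupp.lmapDomain R R f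

lemma cover_comp_freeMap {M N : Type} [AddCommGroup M] [Module R M] [AddCommGroup N]
    [Module R N] (f : M →ₗ[R] N) : (cover R N).comp (freeMap f) = f.comp (cover R M) := by
  ext a
  simp [cover, freeMap, Finsupp.linearCombination_single]

lemma freeMap_ker {M N : Type} [AddCommGroup M] [Module R M] [AddCommGroup N] [Module R N]
    (f : M →ₗ[R] N) :
    ∀ x ∈ LinearMap.ker (cover R M), freeMap f x ∈ LinearMap.ker (cover R N) := by
  intro x hx
  have := congrArg (fun g => g x) (cover_comp_freeMap R f)
  simp only [LinearMap.comp_apply] at this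
  simp only [LinearMap.mem_ker] at hx ⊢
  rw [this, hx, map_zero]

variable {R} in
/-- The induced map on first syzygies. -/
def kerMap {M N : Type} [AddCommGroup M] [Module R M] [AddCommGroup N] [Module R N]
    (f : M →ₗ[R] N) :
    ↥(LinearMap.ker (cover R M)) →ₗ[R] ↥(LinearMap.ker (cover R N)) :=
  (freeMap f).restrict (freeMap_ker R f)

variable {R} in
/-- The induced map on `n`-th syzygies. -/
def syzMap {M N : ModuleCat.{0} R} (f : ↥M →ₗ[R] ↥N) :
    ∀ n, ↥(syz R M n) →ₗ[R] ↥(syz R N n)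
  | 0 => f
  | n + 1 => kerMap (syzMap f n)

variable (S : Type) [Ring S]
variable (U : Type) [AddCommGroup U] [Module R U] [Module S U] [SMulCommClass R S U]

/-- Precomposition `Hom_R(B,U) → Hom_R(A,U)`, as an `S`-linear map (where the `S`-module
structures come from the right `S`-structure of the bimodule `U`). -/
def precompS {A B : Type} [AddCommMonoid A] [Module R A] [AddCommMonoid B] [Module R B]
    (t : A →ₗ[R] B) : (B →ₗ[R] U) →ₗ[S] (A →ₗ[R] U) where
  toFun g := g.comp t
  map_add' g h := LinearMap.add_comp _ _ _
  map_smul' s g := LinearMap.smul_comp _ _ _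

/-- The submodule of `Hom_R(Ω N, U)` consisting of those homomorphisms which extend to
the free cover of `N`. -/
def ext1Sub (N : Type) [AddCommGroup N] [Module R N] :
    Submodule S (↥(LinearMap.ker (cover R N)) →ₗ[R] U) :=
  LinearMap.range (precompS R S U (LinearMap.ker (cover R N)).subtype)

/-- `Ext¹_R(N, U)`, as an `S`-module. -/
def Ext1 (N : Type) [AddCommGroup N] [Module R N] : Type :=
  (↥(LinearMap.ker (cover R N)) →ₗ[R] U) ⧸ ext1Sub R S U N

instance (N : Type) [AddCommGroup N] [Module R N] : AddCommGroup (Ext1 R S U N) :=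
  inferInstanceAs (AddCommGroup (_ ⧸ ext1Sub R S U N))

instance (N : Type) [AddCommGroup N] [Module R N] : Module S (Ext1 R S U N) :=
  inferInstanceAs (Module S (_ ⧸ ext1Sub R S U N))

/-- `Ext^n_R(M, U)`, as an `S`-module: `Ext⁰ = Hom_R(M,U)` and
`Ext^{n+1}(M,U) = Ext¹(Ω^n M, U)` (dimension shifting along the canonical free
resolution of `M`). -/
def ExtU (M : ModuleCat.{0} R) : ℕ → Type
  | 0 => ↥M →ₗ[R] U
  | n + 1 => Ext1 R S U ↥(syz R M n)

instance (M : ModuleCat.{0} R) (n : ℕ) : AddCommGroup (ExtU R S U M n) :=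
  match n with
  | 0 => inferInstanceAs (AddCommGroup (↥M →ₗ[R] U))
  | n + 1 => inferInstanceAs (AddCommGroup (Ext1 R S U ↥(syz R M n)))

instance (M : ModuleCat.{0} R) (n : ℕ) : Module S (ExtU R S U M n) :=
  match n with
  | 0 => inferInstanceAs (Module S (↥M →ₗ[R] U))
  | n + 1 => inferInstanceAs (Module S (Ext1 R S U ↥(syz R M n)))

lemma ext1Sub_le_comap {M N : Type} [AddCommGroup M] [Module R M] [AddCommGroup N]
    [Module R N] (f : M →ₗ[R] N) :
    ext1Sub R S U N ≤ (ext1Sub R S U M).comap (precompS R S U (kerMap f)) := by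
  rintro g ⟨h, rfl⟩
  exact ⟨precompS R S U (freeMap f) h, LinearMap.ext fun x => rfl⟩

variable {R} in
/-- Contravariant functoriality of `Ext¹`. -/
def ext1Map {M N : Type} [AddCommGroup M] [Module R M] [AddCommGroup N] [Module R N]
    (f : M →ₗ[R] N) : Ext1 R S U N →ₗ[S] Ext1 R S U M :=
  Submodule.mapQ _ _ (precompS R S U (kerMap f)) (ext1Sub_le_comap R S U f)

variable {R} in
/-- Contravariant functoriality of `Ext^n`: the map
`Ext^n_R(N,U) → Ext^n_R(M,U)` induced by `f : M → N`; it is `S`-linear. -/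
def extMap {M N : ModuleCat.{0} R} (f : ↥M →ₗ[R] ↥N) :
    ∀ n, ExtU R S U N n →ₗ[S] ExtU R S U M n
  | 0 => precompS R S U f
  | n + 1 => ext1Map S U (syzMap f n)

/-- `Ext^n_R(M,U) = 0`. -/
def extVanish (M : ModuleCat.{0} R) (n : ℕ) : Prop :=
  Subsingleton (ExtU R S U M n)

/-- `grade_U M ≥ i` : `Ext^j_R(M,U) = 0` for all `j < i`. -/
def gradeGE (M : ModuleCat.{0} R) (i : ℕ) : Prop :=
  ∀ j < i, extVanish R S U M j

/-- `grade_U M = g` : `grade_U M ≥ g` and `Ext^g_R(M,U) ≠ 0`. -/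
def gradeEq (M : ModuleCat.{0} R) (g : ℕ) : Prop :=
  gradeGE R S U M g ∧ ¬ extVanish R S U M g

/-- `s.grade_U M ≥ i` : `grade_U B ≥ i` for every submodule `B` of `M`. -/
def sgradeGE (M : ModuleCat.{0} R) (i : ℕ) : Prop :=
  ∀ B : Submodule R ↥M, gradeGE R S U (ModuleCat.of R ↥B) i

/-- Membership in `H_g` : `grade_U M = g` and `Ext^i(M,U) = 0` for all `i ≠ g`. -/
def Hmem (M : ModuleCat.{0} R) (g : ℕ) : Prop :=
  gradeEq R S U M g ∧ ∀ i, i ≠ g → extVanish R S U M i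

/-- The functor `Ext^i_S(Ext^i_R(-,U),U) : mod R → mod R` preserves monomorphisms
(on finitely generated modules). -/
def ExtExtMono [SMulCommClass S R U] (i : ℕ) : Prop :=
  ∀ (X Y : ModuleCat.{0} R), Module.Finite R ↥X → Module.Finite R ↥Y →
    ∀ f : ↥X →ₗ[R] ↥Y, Function.Injective f →
      Function.Injective
        (extMap (R := S) (S := R) U
          (M := ModuleCat.of S (ExtU R S U Y i)) (N := ModuleCat.of S (ExtU R S U X i))
          (extMap (S := S) U f i) i)

/-- `M` is `U`-`k`-torsionfree: for (every) finitely generated projective presentation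
`P₁ → P₀ → M → 0`, with `X = coker (Hom(P₀,U) → Hom(P₁,U))`, one has
`Ext^i_S(X, U) = 0` for `1 ≤ i ≤ k`. -/
def Torsionfree [SMulCommClass S R U] (k : ℕ) (M : ModuleCat.{0} R) : Prop :=
  ∀ (P₁ P₀ : ModuleCat.{0} R), Module.Finite R ↥P₁ → Module.Projective R ↥P₁ →
    Module.Finite R ↥P₀ → Module.Projective R ↥P₀ →
    ∀ (f : ↥P₁ →ₗ[R] ↥P₀) (g : ↥P₀ →ₗ[R] ↥M), Function.Surjective g →
      LinearMap.range f = LinearMap.ker g →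
      ∀ i, 1 ≤ i → i ≤ k →
        extVanish S R U
          (ModuleCat.of S ((↥P₁ →ₗ[R] U) ⧸ LinearMap.range (precompS R S U f))) i

end Ext

section Resol

variable (R : Type) [Ring R] (U : Type) [AddCommGroup U] [Module R U]

/-- `A` belongs to `add U`: it is (isomorphic to) a direct summand of a finite direct
sum of copies of `U`. -/
def InAdd (A : ModuleCat.{0} R) : Prop :=
  ∃ (m : ℕ) (i : ↥A →ₗ[R] (Fin m → U)) (p : (Fin m → U) →ₗ[R] ↥A),
    p.comp i = LinearMap.id

/-- `U`-resolution dimension of `A` is at most `n` : there is an exact sequence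
`0 → U_n → ⋯ → U_0 → A → 0` with all `U_i` in `add U`. -/
def URdimLE : ℕ → ModuleCat.{0} R → Prop
  | 0, A => InAdd R U A
  | n + 1, A => ∃ V : ModuleCat.{0} R, InAdd R U V ∧
      ∃ g : ↥V →ₗ[R] ↥A, Function.Surjective g ∧
        URdimLE n (ModuleCat.of R ↥(LinearMap.ker g))

/-- The `U`-resolution dimension of `A`, as an element of `ℕ∞`. -/
def URdim (A : ModuleCat.{0} R) : ℕ∞ :=
  sInf {c : ℕ∞ | ∃ n : ℕ, c = n ∧ URdimLE R U n A}

/-- `M` is a `k`-syzygy module: there is an exact sequence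
`0 → M → P_{k-1} → ⋯ → P_0 → X → 0` with all `P_i` finitely generated projective. -/
def IsSyzygy : ℕ → ModuleCat.{0} R → Prop
  | 0, _ => True
  | k + 1, M => ∃ P : ModuleCat.{0} R, Module.Finite R ↥P ∧ Module.Projective R ↥P ∧
      ∃ f : ↥M →ₗ[R] ↥P, Function.Injective f ∧
        IsSyzygy k (ModuleCat.of R (↥P ⧸ LinearMap.range f))

/-- `M` is a `U`-`k`-syzygy module: there is an exact sequence
`0 → M → X_0 → X_1 → ⋯ → X_{k-1}` with all `X_i` in `add U`. -/
def IsUSyzygy : ℕ → ModuleCat.{0} R → Prop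
  | 0, _ => True
  | k + 1, M => ∃ V : ModuleCat.{0} R, InAdd R U V ∧
      ∃ f : ↥M →ₗ[R] ↥V, Function.Injective f ∧
        IsUSyzygy k (ModuleCat.of R (↥V ⧸ LinearMap.range f))

/-- The injective dimension of `A` is at most `n` : there is an injective resolution
`0 → A → E_0 → ⋯ → E_n → 0`. -/
def injDimLE : ℕ → ModuleCat.{0} R → Prop
  | 0, A => Module.Injective R ↥A
  | n + 1, A => ∃ E : ModuleCat.{0} R, Module.Injective R ↥E ∧
      ∃ f : ↥A →ₗ[R] ↥E, Function.Injective f ∧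
        injDimLE n (ModuleCat.of R (↥E ⧸ LinearMap.range f))

/-- The injective dimension of `A`, as an element of `ℕ∞`. -/
def injDim (A : ModuleCat.{0} R) : ℕ∞ :=
  sInf {c : ℕ∞ | ∃ n : ℕ, c = n ∧ injDimLE R n A}

/-- `A` is a flat `R`-module (equational criterion for flatness, which makes sense
over an arbitrary, possibly noncommutative, ring): every relation in `A` can be
trivialized. -/
def IsFlat (A : Type) [AddCommGroup A] [Module R A] : Prop :=
  ∀ (n : ℕ) (a : Fin n → R) (x : Fin n → A), (∑ i, a i • x i) = 0 →
    ∃ (k : ℕ) (b : Fin n → Fin k → R) (y : Fin k → A),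
      (∀ i, x i = ∑ j, b i j • y j) ∧ ∀ j, (∑ i, a i * b i j) = 0

/-- The flat dimension of `A` is at most `n` : there is a flat resolution
`0 → F_n → ⋯ → F_0 → A → 0`. -/
def flatDimLE : ℕ → ModuleCat.{0} R → Prop
  | 0, A => IsFlat R ↥A
  | n + 1, A => ∃ F : ModuleCat.{0} R, IsFlat R ↥F ∧
      ∃ g : ↥F →ₗ[R] ↥A, Function.Surjective g ∧
        flatDimLE n (ModuleCat.of R ↥(LinearMap.ker g))

/-- `A` is cogenerated by `U` : it embeds into a direct product of copies of `U`. -/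
def Cogenerated (A : ModuleCat.{0} R) : Prop :=
  ∃ (ι : Type) (f : ↥A →ₗ[R] (ι → U)), Function.Injective f

/-- A minimal injective resolution `0 → M → E 0 → E 1 → ⋯` of `M` : an injective
resolution in which the kernel of each differential is an essential submodule. -/
structure MinInjRes (M : Type) [AddCommGroup M] [Module R M] where
  E : ℕ → ModuleCat.{0} R
  injective : ∀ n, Module.Injective R ↥(E n)
  ι : M →ₗ[R] ↥(E 0)
  d : ∀ n, ↥(E n) →ₗ[R] ↥(E (n + 1))
  ι_inj : Function.Injective ι
  exact_zero : LinearMap.ker (d 0) = LinearMap.range ι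
  exact_succ : ∀ n, LinearMap.ker (d (n + 1)) = LinearMap.range (d n)
  essential : ∀ n (B : Submodule R ↥(E n)), B ⊓ LinearMap.ker (d n) = ⊥ → B = ⊥

end Resol

section Bimodule

variable (Λ Γ : Type) [Ring Λ] [Ring Γ]
variable (U : Type) [AddCommGroup U] [Module Λ U] [Module Γᵐᵒᵖ U]
  [SMulCommClass Λ Γᵐᵒᵖ U] [SMulCommClass Γᵐᵒᵖ Λ U]

/-- Left multiplication `u ↦ a • u` as a `Γᵒᵖ`-linear endomorphism of `U`. -/
def lmul (a : Λ) : U →ₗ[Γᵐᵒᵖ] U where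
  toFun u := a • u
  map_add' := smul_add a
  map_smul' γ u := smul_comm a γ u

/-- Right multiplication `u ↦ u γ` as a `Λ`-linear endomorphism of `U`. -/
def rmul (γ : Γᵐᵒᵖ) : U →ₗ[Λ] U where
  toFun u := γ • u
  map_add' := smul_add γ
  map_smul' a u := smul_comm γ a u

/-- `U` is a faithfully balanced `(Λ,Γ)`-bimodule: the natural maps
`Λ → End(U_Γ)` and `Γ → End(_ΛU)^op` are isomorphisms. -/
def FaithfullyBalanced : Prop :=
  Function.Bijective (lmul Λ Γ U) ∧ Function.Bijective (rmul Λ Γ U)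

/-- `U` is selforthogonal: `Ext^i_Λ(U,U) = 0 = Ext^i_Γ(U,U)` for all `i ≥ 1`. -/
def SelfOrthogonal : Prop :=
  (∀ i, 1 ≤ i → extVanish Λ Γᵐᵒᵖ U (ModuleCat.of Λ U) i) ∧
  (∀ i, 1 ≤ i → extVanish Γᵐᵒᵖ Λ U (ModuleCat.of Γᵐᵒᵖ U) i)

/-- `_ΛU` is `k`-Gorenstein : `s.grade_U Ext^i_Γ(N,U) ≥ i` for every
`N ∈ mod Γᵒᵖ` and all `1 ≤ i ≤ k`. -/
def LeftGorenstein (k : ℕ) : Prop :=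
  ∀ N : ModuleCat.{0} Γᵐᵒᵖ, Module.Finite Γᵐᵒᵖ ↥N →
    ∀ i, 1 ≤ i → i ≤ k →
      sgradeGE Λ Γᵐᵒᵖ U (ModuleCat.of Λ (ExtU Γᵐᵒᵖ Λ U N i)) i

/-- `U_Γ` is `k`-Gorenstein : `s.grade_U Ext^i_Λ(M,U) ≥ i` for every
`M ∈ mod Λ` and all `1 ≤ i ≤ k`. -/
def RightGorenstein (k : ℕ) : Prop :=
  ∀ M : ModuleCat.{0} Λ, Module.Finite Λ ↥M →
    ∀ i, 1 ≤ i → i ≤ k →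
      sgradeGE Γᵐᵒᵖ Λ U (ModuleCat.of Γᵐᵒᵖ (ExtU Λ Γᵐᵒᵖ U M i)) i

end Bimodule

section Aux1

open CategoryTheory CategoryTheory.Abelian

variable {R : Type} [Ring R]

/-- Short complex of modules from linear maps. -/
def scx {A B C : ModuleCat.{0} R} (f : ↥A →ₗ[R] ↥B) (g : ↥B →ₗ[R] ↥C)
    (h : LinearMap.range f = LinearMap.ker g) : ShortComplex (ModuleCat.{0} R) :=
  ShortComplex.mk (ModuleCat.ofHom f) (ModuleCat.ofHom g) (by
    ext x
    have : f x ∈ LinearMap.ker g := h ▸ ⟨x, rfl⟩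
    simpa using this)

lemma scx_exact {A B C : ModuleCat.{0} R} (f : ↥A →ₗ[R] ↥B) (g : ↥B →ₗ[R] ↥C)
    (h : LinearMap.range f = LinearMap.ker g) (hf : Function.Injective f)
    (hg : Function.Surjective g) : (scx f g h).ShortExact := by
  refine ShortComplex.ShortExact.mk' ?_ ?_ ?_
  · rw [ShortComplex.moduleCat_exact_iff_range_eq_ker]
    exact h
  · exact (ModuleCat.mono_iff_injective _).2 hf
  · exact (ModuleCat.epi_iff_surjective _).2 hg

/-- `e ∈ Ext^n(X,B)` is a dimension-shift class. -/
def Shift (X B : ModuleCat.{0} R) (n : ℕ) (e : Ext X B n) : Prop :=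
  ∀ (Y : ModuleCat.{0} R) (m k : ℕ) (h : n + m = k), 1 ≤ m →
    Function.Bijective (fun x : Ext B Y m => e.comp x h)

lemma shift_zero (X : ModuleCat.{0} R) : Shift X X 0 (Ext.mk₀ (𝟙 X)) := by
  intro Y m k h hm
  obtain rfl : m = k := by omega
  simp only [Ext.mk₀_id_comp]
  exact Function.bijective_id

lemma shift_succ {X A P B : ModuleCat.{0} R} {n : ℕ} {e : Ext X B n} (he : Shift X B n e)
    (f : ↥A →ₗ[R] ↥P) (g : ↥P →ₗ[R] ↥B)
    (h : LinearMap.range f = LinearMap.ker g) (hf : Function.Injective f)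
    (hg : Function.Surjective g) [Projective P] :
    ∃ e' : Ext X A (n + 1), Shift X A (n + 1) e' ∧
      ∀ Y : ModuleCat.{0} R,
        Function.Surjective (fun φ : ↥A →ₗ[R] ↥Y =>
          e'.comp (Ext.mk₀ (ModuleCat.ofHom φ)) (add_zero (n + 1))) ∧
        ∀ φ : ↥A →ₗ[R] ↥Y,
          e'.comp (Ext.mk₀ (ModuleCat.ofHom φ)) (add_zero (n + 1)) = 0 ↔
            ∃ ψ : ↥P →ₗ[R] ↥Y, ψ.comp f = φ := by
  have hS := scx_exact f g h hf hg
  let d : Ext B A 1 := hS.extClass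
  have hsurj : ∀ (Y : ModuleCat.{0} R) (m k : ℕ) (hk : 1 + m = k) (x : Ext B Y k),
      ∃ x1 : Ext A Y m, d.comp x1 hk = x := by
    intro Y m k hk x
    refine Ext.contravariant_sequence_exact₃ hS Y x ?_ hk
    obtain ⟨k, rfl⟩ : ∃ k', k = k' + 1 := ⟨m, by omega⟩
    exact Ext.eq_zero_of_projective (P := P) _
  have hker : ∀ (Y : ModuleCat.{0} R) (m k : ℕ) (hk : 1 + m = k) (x : Ext A Y m),
      d.comp x hk = 0 → ∃ x2 : Ext P Y m,
        (Ext.mk₀ (ModuleCat.ofHom f)).comp x2 (zero_add m) = x := by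
    intro Y m k hk x hx
    exact Ext.contravariant_sequence_exact₁ hS Y x hk hx
  have hcomp : d.comp (Ext.mk₀ (ModuleCat.ofHom f)) (add_zero 1) = 0 := hS.extClass_comp
  refine ⟨e.comp d rfl, ?_, ?_⟩
  · intro Y m k hk hm
    have key : ∀ x : Ext A Y m, (e.comp d rfl).comp x hk
        = e.comp (d.comp x rfl) (show n + (1 + m) = k by omega) := fun x => Ext.comp_assoc _ _ _ _ _ (by omega)
    simp only [key]
    have h1 := he Y (1 + m) k (by omega) (by omega)
    refine h1.comp (f := fun x : Ext A Y m => d.comp x rfl) ⟨?_, ?_⟩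
    · intro x y hxy
      have hz : d.comp (x - y) rfl = 0 := by
        simp only at hxy
        rw [sub_eq_add_neg, Ext.comp_add, Ext.comp_neg, hxy, add_neg_cancel]
      obtain ⟨x2, hx2⟩ := hker Y m _ rfl _ hz
      obtain ⟨m, rfl⟩ : ∃ m', m = m' + 1 := ⟨m - 1, by omega⟩
      rw [Ext.eq_zero_of_projective x2, Ext.comp_zero] at hx2
      exact (sub_eq_zero.1 hx2.symm)
    · intro x
      exact hsurj Y m _ rfl x
  · intro Y
    have key : ∀ x : Ext A Y 0, (e.comp d rfl).comp x (add_zero (n + 1))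
        = e.comp (d.comp x (add_zero 1)) rfl := fun x => Ext.comp_assoc _ _ _ _ _ rfl
    simp only [key]
    have h1 := he Y 1 (n + 1) rfl le_rfl
    constructor
    · intro t
      obtain ⟨y, rfl⟩ := h1.2 t
      obtain ⟨x, rfl⟩ := hsurj Y 0 1 rfl y
      refine ⟨(Ext.addEquiv₀ x).hom, ?_⟩
      simp
    · intro φ
      constructor
      · intro h0
        have h2 : d.comp (Ext.mk₀ (ModuleCat.ofHom φ)) (add_zero 1) = 0 := by
          apply h1.1
          simp only [h0, Ext.comp_zero]
        obtain ⟨x2, hx2⟩ := hker Y 0 1 _ _ h2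
        refine ⟨(Ext.addEquiv₀ x2).hom, ?_⟩
        obtain ⟨ψ, rfl⟩ := (Ext.mk₀_bijective _ _).2 x2
        rw [Ext.mk₀_comp_mk₀] at hx2
        have h3 := (Ext.mk₀_bijective _ _).1 hx2
        have h4 : Ext.addEquiv₀ (Ext.mk₀ ψ) = ψ := (Ext.addEquiv₀.symm_apply_eq.1 rfl).symm
        rw [h4]
        ext a
        exact congrArg (fun q => q.hom a) h3
      · rintro ⟨ψ, rfl⟩
        have : Ext.mk₀ (ModuleCat.ofHom (ψ.comp f)) =
            (Ext.mk₀ (ModuleCat.ofHom f)).comp (Ext.mk₀ (ModuleCat.ofHom ψ)) (zero_add 0) := by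
          rw [Ext.mk₀_comp_mk₀]; rfl
        rw [this, ← Ext.comp_assoc_of_second_deg_zero, hcomp, Ext.zero_comp, Ext.comp_zero]

lemma cover_surj (M : Type) [AddCommGroup M] [Module R M] :
    Function.Surjective (cover R M) := fun m =>
  ⟨Finsupp.single m 1, by simp [cover, Finsupp.linearCombination_single]⟩

lemma shift_syz (X : ModuleCat.{0} R) : ∀ n, ∃ e, Shift X (syz R X n) n e
  | 0 => ⟨_, shift_zero X⟩
  | n + 1 => by
    obtain ⟨e, he⟩ := shift_syz X n
    obtain ⟨e', he', -⟩ := shift_succ (A := syz R X (n + 1))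
      (P := ModuleCat.of R (↥(syz R X n) →₀ R)) he
      (LinearMap.ker (cover R (syz R X n))).subtype (cover R (syz R X n))
      (Submodule.range_subtype _) (Submodule.subtype_injective _) (cover_surj _)
    exact ⟨e', he'⟩

lemma shift_syz' (X : ModuleCat.{0} R) (n : ℕ) : 
    ∃ e' : Ext X (ModuleCat.of R (LinearMap.ker (cover R (syz R X n)))) (n + 1),
      ∀ Y : ModuleCat.{0} R,
        Function.Surjective (fun φ : ↥(LinearMap.ker (cover R (syz R X n))) →ₗ[R] ↥Y =>
          e'.comp (Ext.mk₀ (ModuleCat.ofHom φ)) (add_zero (n + 1))) ∧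
        ∀ φ : ↥(LinearMap.ker (cover R (syz R X n))) →ₗ[R] ↥Y,
          e'.comp (Ext.mk₀ (ModuleCat.ofHom φ)) (add_zero (n + 1)) = 0 ↔
            ∃ ψ : (↥(syz R X n) →₀ R) →ₗ[R] ↥Y,
              ψ.comp (LinearMap.ker (cover R (syz R X n))).subtype = φ := by
  obtain ⟨e, he⟩ := shift_syz X n
  obtain ⟨e', -, he'⟩ := shift_succ (A := ModuleCat.of R (LinearMap.ker (cover R (syz R X n))))
      (P := ModuleCat.of R (↥(syz R X n) →₀ R)) he
      (LinearMap.ker (cover R (syz R X n))).subtype (cover R (syz R X n))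
      (Submodule.range_subtype _) (Submodule.subtype_injective _) (cover_surj _)
  exact ⟨e', he'⟩

variable (S : Type) [Ring S]
variable (U : Type) [AddCommGroup U] [Module R U] [Module S U] [SMulCommClass R S U]

lemma ext_zero_of_extVanish (A : ModuleCat.{0} R) (n : ℕ)
    (h : extVanish R S U A (n + 1)) (x : Ext A (ModuleCat.of R U) (n + 1)) : x = 0 := by
  obtain ⟨e', he'⟩ := shift_syz' A n
  obtain ⟨φ, rfl⟩ := (he' (ModuleCat.of R U)).1 x
  refine ((he' (ModuleCat.of R U)).2 φ).2 ?_
  have : Subsingleton ((↥(LinearMap.ker (cover R (syz R A n))) →ₗ[R] U) ⧸ ext1Sub R S U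
    (syz R A n)) := h
  have hφ : (φ : ↥(LinearMap.ker (cover R (syz R A n))) →ₗ[R] U) ∈ ext1Sub R S U
    (syz R A n) :=
    (Submodule.Quotient.mk_eq_zero _).1 (Subsingleton.elim _ _)
  obtain ⟨ψ, hψ⟩ := hφ
  exact ⟨ψ, hψ⟩

/-- Comparing two quotients. -/
lemma quot_equiv {S A B T : Type} [Ring S] [AddCommGroup A] [Module S A] [AddCommGroup B]
    [Module S B] [AddCommGroup T] (t : S → T → T) (α : A →+ T) (β : B →+ T)
    (hα : Function.Surjective α) (hβ : Function.Surjective β)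
    (hαt : ∀ s a, α (s • a) = t s (α a)) (hβt : ∀ s a, β (s • a) = t s (β a))
    (p : Submodule S A) (q : Submodule S B) (hp : ∀ a, α a = 0 ↔ a ∈ p)
    (hq : ∀ a, β a = 0 ↔ a ∈ q) : Nonempty ((A ⧸ p) ≃ₗ[S] (B ⧸ q)) := by
  let : SMul S T := ⟨t⟩
  let : Module S T := Function.Surjective.module S α hα hαt
  let α' : A →ₗ[S] T := { α with map_smul' := hαt }
  let β' : B →ₗ[S] T := { β with map_smul' := hβt }
  have hp' : p = LinearMap.ker α' := by ext a; exact (hp a).symm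
  have hq' : q = LinearMap.ker β' := by ext a; exact (hq a).symm
  subst hp' hq'
  exact ⟨(α'.quotKerEquivOfSurjective hα).trans (β'.quotKerEquivOfSurjective hβ).symm⟩

lemma ext_quot_equiv {X A P B : ModuleCat.{0} R} {n : ℕ} {e : Ext X B n} (he : Shift X B n e)
    (f : ↥A →ₗ[R] ↥P) (g : ↥P →ₗ[R] ↥B)
    (h : LinearMap.range f = LinearMap.ker g) (hf : Function.Injective f)
    (hg : Function.Surjective g) [Projective P] :
    Nonempty (((↥A →ₗ[R] U) ⧸ LinearMap.range (precompS R S U f)) ≃ₗ[S]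
      ExtU R S U X (n + 1)) := by
  obtain ⟨a, -, ha⟩ := shift_succ he f g h hf hg
  obtain ⟨b, hb⟩ := shift_syz' X n
  have ha := ha (ModuleCat.of R U)
  have hb := hb (ModuleCat.of R U)
  let sm : S → (U →ₗ[R] U) := fun s =>
    { toFun := fun u => s • u
      map_add' := smul_add s
      map_smul' := fun r u => (smul_comm r s u).symm }
  refine quot_equiv (S := S) (T := Ext X (ModuleCat.of R U) (n + 1))
    (fun s x => x.comp (Ext.mk₀ (ModuleCat.ofHom (sm s))) (add_zero _))
    (AddMonoidHom.mk' (fun φ : ↥A →ₗ[R] U =>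
      a.comp (Ext.mk₀ (ModuleCat.ofHom (Y := U) φ)) (add_zero (n + 1))) ?_)
    (AddMonoidHom.mk' (fun φ : ↥(LinearMap.ker (cover R (syz R X n))) →ₗ[R] U =>
      b.comp (Ext.mk₀ (ModuleCat.ofHom (Y := U) φ)) (add_zero (n + 1))) ?_)
    ha.1 hb.1 ?_ ?_ _ _ ha.2 hb.2
  · intro x y
    rw [← Ext.comp_add, ← Ext.mk₀_add]; rfl
  · intro x y
    rw [← Ext.comp_add, ← Ext.mk₀_add]; rfl
  · intro s φ
    simp only [AddMonoidHom.mk'_apply, Ext.comp_assoc_of_second_deg_zero, Ext.mk₀_comp_mk₀]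
    rfl
  · intro s φ
    simp only [AddMonoidHom.mk'_apply, Ext.comp_assoc_of_second_deg_zero, Ext.mk₀_comp_mk₀]
    rfl

end Aux1
section Aux2

open CategoryTheory CategoryTheory.Abelian

variable {R : Type} [Ring R] {U : Type} [AddCommGroup U] [Module R U]

lemma IsUSyzygy.of_equiv {k : ℕ} {M N : ModuleCat.{0} R} (e : ↥M ≃ₗ[R] ↥N)
    (h : IsUSyzygy R U k N) : IsUSyzygy R U k M := by
  cases k with
  | zero => trivial
  | succ k =>
    obtain ⟨V, hV, f, hf, h⟩ := h
    refine ⟨V, hV, f.comp e.toLinearMap, hf.comp e.injective, ?_⟩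
    have : LinearMap.range (f.comp e.toLinearMap) = LinearMap.range f :=
      LinearMap.range_comp_of_range_eq_top _ (LinearMap.range_eq_top.2 e.surjective)
    rw [this]
    exact h

lemma IsUSyzygy.of_inj {M N : ModuleCat.{0} R} (e : ↥M →ₗ[R] ↥N) (he : Function.Injective e)
    (h : IsUSyzygy R U 1 N) : IsUSyzygy R U 1 M := by
  obtain ⟨V, hV, f, hf, h⟩ := h
  exact ⟨V, hV, f.comp e, hf.comp he, trivial⟩

variable (S : Type) [Ring S] [Module S U] [SMulCommClass R S U] [SMulCommClass S R U]

lemma lin_eq_sum {n : ℕ} {B : Type} [AddCommGroup B] [Module S B] (ψ : (Fin n → S) →ₗ[S] B)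
    (x : Fin n → S) : ψ x = ∑ i, x i • ψ (Pi.single i 1) := by
  conv_lhs => rw [← Finset.univ_sum_single x]
  rw [map_sum]
  refine Finset.sum_congr rfl fun i _ => ?_
  rw [← map_smul, ← Pi.single_smul, smul_eq_mul, mul_one]

variable (R U) in
lemma usyz_dual [IsNoetherianRing S] (k : ℕ) : ∀ A : ModuleCat.{0} S, Module.Finite S ↥A →
    (∀ j, 1 ≤ j → j + 2 ≤ k → ∀ x : Ext A (ModuleCat.of S U) j, x = 0) →
    IsUSyzygy R U k (ModuleCat.of R (↥A →ₗ[S] U)) := by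
  induction k with
  | zero => intros; trivial
  | succ k ih =>
    intro A hA hx
    obtain ⟨n, q, hq⟩ := Module.Finite.exists_fin' S ↥A
    let f : (↥A →ₗ[S] U) →ₗ[R] (Fin n → U) :=
      { toFun := fun φ i => φ (q (Pi.single i 1))
        map_add' := fun _ _ => rfl
        map_smul' := fun _ _ => rfl }
    have hfs : ∀ (φ : ↥A →ₗ[S] U) (x : Fin n → S), φ (q x) = ∑ i, x i • f φ i := fun φ x =>
      lin_eq_sum S (φ.comp q) x
    have hf : Function.Injective f := by
      intro φ ψ h
      ext a
      obtain ⟨x, rfl⟩ := hq a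
      rw [hfs, hfs, h]
    let θ : (Fin n → U) →ₗ[R] (↥(LinearMap.ker q) →ₗ[S] U) :=
      { toFun := fun v => (Fintype.linearCombination S v).comp (LinearMap.ker q).subtype
        map_add' := fun v w => by
          ext x
          simp [Fintype.linearCombination_apply, Finset.sum_add_distrib]
        map_smul' := fun r v => by
          ext x
          simp [Fintype.linearCombination_apply, Finset.smul_sum, smul_comm r] }
    have hθ : ∀ v x, θ v x = ∑ i, (x : Fin n → S) i • v i := fun v x =>
      Fintype.linearCombination_apply S v (x : Fin n → S)
    have hr : LinearMap.range f = LinearMap.ker θ := by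
      apply le_antisymm
      · rintro _ ⟨φ, rfl⟩
        rw [LinearMap.mem_ker]
        ext x
        rw [hθ, ← hfs, LinearMap.mem_ker.1 x.2]
        simp
      · intro v hv
        have hle : LinearMap.ker q ≤ LinearMap.ker (Fintype.linearCombination S v) := by
          intro x hx
          exact congrArg (fun g => g ⟨x, hx⟩) (LinearMap.mem_ker.1 hv)
        refine ⟨((LinearMap.ker q).liftQ _ hle).comp
          (q.quotKerEquivOfSurjective hq).symm.toLinearMap, ?_⟩
        ext i
        have : (q.quotKerEquivOfSurjective hq).symm (q (Pi.single i 1)) =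
            Submodule.Quotient.mk (Pi.single i 1) := by
          rw [LinearEquiv.symm_apply_eq]; rfl
        simp [f, this, Fintype.linearCombination_apply, Pi.single_apply]
    refine ⟨ModuleCat.of R (Fin n → U), ⟨n, LinearMap.id, LinearMap.id, rfl⟩, f, hf, ?_⟩
    rcases Nat.lt_or_ge k 1 with h0 | h1
    · obtain rfl : k = 0 := by omega
      trivial
    have e1 : ((Fin n → U) ⧸ LinearMap.range f) ≃ₗ[R] ↥(LinearMap.range θ) :=
      (Submodule.quotEquivOfEq _ _ hr).trans θ.quotKerEquivRange
    obtain ⟨d, hd, hd'⟩ := shift_succ (A := ModuleCat.of S ↥(LinearMap.ker q))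
      (P := ModuleCat.of S (Fin n → S)) (shift_zero A) (LinearMap.ker q).subtype q
      (Submodule.range_subtype _) (Submodule.subtype_injective _) hq
    have hker := ih (ModuleCat.of S ↥(LinearMap.ker q)) inferInstance (by
      intro j hj hjk x
      apply (hd (ModuleCat.of S U) j (j + 1) (by omega) hj).1
      simp only [Ext.comp_zero]
      exact hx _ (by omega) (by omega) _)
    rcases Nat.lt_or_ge k 2 with h0 | h2
    · obtain rfl : k = 1 := by omega
      exact hker.of_inj ((LinearMap.range θ).subtype.comp e1.toLinearMap)
        ((Submodule.subtype_injective _).comp e1.injective)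
    · have hsurj : LinearMap.range θ = ⊤ := by
        rw [LinearMap.range_eq_top]
        intro φ
        obtain ⟨ψ, hψ⟩ := ((hd' (ModuleCat.of S U)).2 φ).1 (hx 1 le_rfl (by omega) _)
        refine ⟨fun i => ψ (Pi.single i 1), ?_⟩
        rw [← hψ]
        ext x
        rw [hθ]
        exact (lin_eq_sum S ψ x).symm
      exact hker.of_equiv (e1.trans (LinearEquiv.ofTop _ hsurj))

end Aux2
section Aux3

open CategoryTheory CategoryTheory.Abelian

variable (R S : Type) [Ring R] [Ring S] (U : Type) [AddCommGroup U] [Module R U]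
  [Module S U] [SMulCommClass R S U] [SMulCommClass S R U]

/-- The evaluation map `M → M**`. -/
def evl (M : Type) [AddCommGroup M] [Module R M] : M →ₗ[R] ((M →ₗ[R] U) →ₗ[S] U) where
  toFun m := { toFun := fun φ => φ m, map_add' := fun _ _ => rfl, map_smul' := fun _ _ => rfl }
  map_add' x y := by ext φ; exact map_add φ x y
  map_smul' r x := by ext φ; exact map_smul φ r x

lemma evl_apply (M : Type) [AddCommGroup M] [Module R M] (m : M) (φ : M →ₗ[R] U) :
    evl R S U M m φ = φ m := rfl

/-- The map `u ↦ (x ↦ s(x)_i u)`. -/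
def coordDual {P : Type} [AddCommGroup P] [Module R P] (c : P →ₗ[R] R) : U →ₗ[S] (P →ₗ[R] U) where
  toFun u := c.smulRight u
  map_add' u v := by ext x; simp
  map_smul' s u := by ext x; exact smul_comm (c x) s u

lemma coordDual_apply {P : Type} [AddCommGroup P] [Module R P] (c : P →ₗ[R] R) (u : U) (x : P) :
    coordDual R S U c u x = c x • u := rfl

lemma dual_basis (P : Type) [AddCommGroup P] [Module R P] [Module.Finite R P]
    [Module.Projective R P] : ∃ (n : ℕ) (p : Fin n → P) (c : Fin n → (P →ₗ[R] R)),
      ∀ x, x = ∑ i, c i x • p i := by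
  obtain ⟨n, q, hq⟩ := Module.Finite.exists_fin' R P
  obtain ⟨s, hs⟩ := Module.projective_lifting_property q LinearMap.id hq
  refine ⟨n, fun i => q (Pi.single i 1), fun i => (LinearMap.proj i).comp s, fun x => ?_⟩
  have := lin_eq_sum R q (s x)
  rw [← LinearMap.comp_apply, hs] at this
  exact this

lemma dual_decomp {P : Type} [AddCommGroup P] [Module R P] {n : ℕ} (p : Fin n → P)
    (c : Fin n → (P →ₗ[R] R)) (h : ∀ x, x = ∑ i, c i x • p i) (φ : P →ₗ[R] U) :
    φ = ∑ i, coordDual R S U (c i) (evl R S U P (p i) φ) := by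
  ext x
  conv_lhs => rw [h x]
  simp [coordDual_apply, evl_apply, LinearMap.sum_apply]

lemma evl_inj_of_proj (hinj : ∀ a : R, (∀ u : U, a • u = 0) → a = 0)
    (P : Type) [AddCommGroup P] [Module R P] [Module.Finite R P]
    [Module.Projective R P] : Function.Injective (evl R S U P) := by
  obtain ⟨n, p, c, h⟩ := dual_basis R P
  rw [injective_iff_map_eq_zero]
  intro x hx
  rw [h x]
  refine Finset.sum_eq_zero fun i _ => ?_
  rw [hinj (c i x), zero_smul]
  intro u
  exact congrArg (fun g => g (coordDual R S U (c i) u)) hx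

lemma evl_surj_of_proj (hsurj : ∀ φ : U →ₗ[S] U, ∃ a : R, ∀ u : U, φ u = a • u)
    (P : Type) [AddCommGroup P] [Module R P] [Module.Finite R P]
    [Module.Projective R P] : Function.Surjective (evl R S U P) := by
  obtain ⟨n, p, c, h⟩ := dual_basis R P
  intro Φ
  choose a ha using fun i => hsurj (Φ.comp (coordDual R S U (c i)))
  refine ⟨∑ i, a i • p i, ?_⟩
  ext φ
  conv_rhs => rw [dual_decomp R S U p c h φ, map_sum]
  rw [evl_apply, map_sum]
  refine Finset.sum_congr rfl fun i _ => ?_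
  rw [map_smul, ← evl_apply R S U, ← ha i]
  rfl

lemma ext_dual_proj (hU : ∀ j, 1 ≤ j → ∀ x : Ext (ModuleCat.of S U) (ModuleCat.of S U) j, x = 0)
    (P : Type) [AddCommGroup P] [Module R P] [Module.Finite R P]
    [Module.Projective R P] (j : ℕ) (hj : 1 ≤ j)
    (x : Ext (ModuleCat.of S (P →ₗ[R] U)) (ModuleCat.of S U) j) : x = 0 := by
  obtain ⟨n, p, c, h⟩ := dual_basis R P
  have hid : 𝟙 (ModuleCat.of S (P →ₗ[R] U)) =
      ∑ i, ModuleCat.ofHom (evl R S U P (p i)) ≫ ModuleCat.ofHom (coordDual R S U (c i)) := by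
    ext φ : 2
    rw [ModuleCat.hom_sum, LinearMap.sum_apply]
    exact dual_decomp R S U p c h φ
  rw [← Ext.mk₀_id_comp x, hid, Ext.mk₀_sum, Ext.sum_comp]
  refine Finset.sum_eq_zero fun i _ => ?_
  rw [← Ext.mk₀_comp_mk₀_assoc, hU j hj ((Ext.mk₀ _).comp x _), Ext.comp_zero]

/-- Torsionfreeness conditions in terms of the evaluation map. -/
def TF (k : ℕ) (M : ModuleCat.{0} R) : Prop :=
  (1 ≤ k → Function.Injective (evl R S U ↥M)) ∧ (2 ≤ k → Function.Surjective (evl R S U ↥M)) ∧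
    ∀ j, 1 ≤ j → j + 2 ≤ k →
      ∀ x : Ext (ModuleCat.of S (↥M →ₗ[R] U)) (ModuleCat.of S U) j, x = 0

lemma finite_dual [IsNoetherianRing S] [Module.Finite S U] (M : Type) [AddCommGroup M]
    [Module R M] [Module.Finite R M] : Module.Finite S (M →ₗ[R] U) := by
  obtain ⟨n, q, hq⟩ := Module.Finite.exists_fin' R M
  let f : (M →ₗ[R] U) →ₗ[S] (Fin n → U) :=
      { toFun := fun φ i => φ (q (Pi.single i 1))
        map_add' := fun _ _ => rfl
        map_smul' := fun _ _ => rfl }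
  refine Module.Finite.of_injective f ?_
  intro φ ψ h
  ext a
  obtain ⟨x, rfl⟩ := hq a
  have h1 := lin_eq_sum R (φ.comp q) x
  have h2 := lin_eq_sum R (ψ.comp q) x
  simp only [LinearMap.comp_apply] at h1 h2
  rw [h1, h2]
  exact Finset.sum_congr rfl fun i _ => congrArg (fun t => x i • t) (congrFun h i)

lemma TF.usyz [IsNoetherianRing S] [Module.Finite S U] {k : ℕ} {M : ModuleCat.{0} R}
    [Module.Finite R ↥M] (h : TF R S U k M) : IsUSyzygy R U k M := by
  rcases Nat.lt_or_ge k 1 with h0 | h1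
  · obtain rfl : k = 0 := by omega
    trivial
  have hd := usyz_dual R U S k (ModuleCat.of S (↥M →ₗ[R] U)) (finite_dual R S U ↥M) h.2.2
  rcases Nat.lt_or_ge k 2 with h0 | h2
  · obtain rfl : k = 1 := by omega
    exact hd.of_inj (evl R S U ↥M) (h.1 h1)
  · exact hd.of_equiv (LinearEquiv.ofBijective (evl R S U ↥M) ⟨h.1 h1, h.2.1 h2⟩)

lemma les_third {A B C Y : ModuleCat.{0} S} (f : ↥A →ₗ[S] ↥B) (g : ↥B →ₗ[S] ↥C)
    (h : LinearMap.range f = LinearMap.ker g) (hf : Function.Injective f)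
    (hg : Function.Surjective g) (j : ℕ) (hB : ∀ x : Ext B Y (j + 1), x = 0)
    (h0 : j = 0 → ∀ φ : ↥A →ₗ[S] ↥Y, ∃ ψ : ↥B →ₗ[S] ↥Y, ψ.comp f = φ)
    (hA : 1 ≤ j → ∀ x : Ext A Y j, x = 0) (y : Ext C Y (j + 1)) : y = 0 := by
  have s2 := scx_exact f g h hf hg
  obtain ⟨z, hz⟩ := Ext.contravariant_sequence_exact₃ s2 Y y (hB _) (add_comm 1 j)
  rw [← hz]
  rcases Nat.eq_zero_or_pos j with rfl | hjpos
  · obtain ⟨φ, rfl⟩ := (Ext.mk₀_bijective _ _).2 z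
    obtain ⟨ψ, hψ⟩ := h0 rfl φ.hom
    have hφ : φ = (scx f g h).f ≫ ModuleCat.ofHom ψ := by
      ext a
      exact (congrArg (fun t => t a) hψ).symm
    have h2 : Ext.mk₀ φ = (Ext.mk₀ (scx f g h).f).comp
        (Ext.mk₀ (ModuleCat.ofHom ψ)) (zero_add 0) := by
      rw [hφ]
      exact (Ext.mk₀_comp_mk₀ _ _).symm
    rw [h2, ← Ext.comp_assoc_of_second_deg_zero]
    have h3 := s2.extClass_comp
    exact (congrArg (fun t => Ext.comp t (Ext.mk₀ (ModuleCat.ofHom ψ)) (add_zero 1)) h3).trans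
      (Ext.zero_comp _ _ _ _ _)
  · have : z = 0 := hA hjpos z
    rw [this, Ext.comp_zero]
    rfl

lemma les_mid {A B C Y : ModuleCat.{0} S} (f : ↥A →ₗ[S] ↥B) (g : ↥B →ₗ[S] ↥C)
    (h : LinearMap.range f = LinearMap.ker g) (hf : Function.Injective f)
    (hg : Function.Surjective g) (j : ℕ) (hA : ∀ x : Ext A Y j, x = 0)
    (hC : ∀ x : Ext C Y j, x = 0) (y : Ext B Y j) : y = 0 := by
  have s1 := scx_exact f g h hf hg
  obtain ⟨z, hz⟩ := Ext.contravariant_sequence_exact₂ s1 Y y (hA _)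
  rw [← hz]
  have : z = 0 := hC z
  rw [this, Ext.comp_zero]
  rfl

lemma TF_step (hinj : ∀ a : R, (∀ u : U, a • u = 0) → a = 0)
    (hsurj : ∀ φ : U →ₗ[S] U, ∃ a : R, ∀ u : U, φ u = a • u)
    (hU : ∀ j, 1 ≤ j → ∀ x : Ext (ModuleCat.of S U) (ModuleCat.of S U) j, x = 0)
    {M P N : ModuleCat.{0} R} [Module.Finite R ↥P] [Module.Projective R ↥P]
    (f : ↥M →ₗ[R] ↥P) (g : ↥P →ₗ[R] ↥N)
    (h : LinearMap.range f = LinearMap.ker g) (hf : Function.Injective f)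
    (hg : Function.Surjective g) (k : ℕ) (hN : TF R S U k N)
    (hE0 : 1 ≤ k → ∀ φ : ((↥M →ₗ[R] U) ⧸ LinearMap.range (precompS R S U f)) →ₗ[S] U, φ = 0)
    (hE : ∀ j, 1 ≤ j → j < k →
      ∀ x : Ext (ModuleCat.of S ((↥M →ₗ[R] U) ⧸ LinearMap.range (precompS R S U f)))
        (ModuleCat.of S U) j, x = 0) :
    TF R S U (k + 1) M := by
  refine ⟨fun _ => ?_, fun hk => ?_, fun j hj hjk x => ?_⟩
  · rw [injective_iff_map_eq_zero]
    intro m hm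
    apply hf
    rw [map_zero]
    apply evl_inj_of_proj R S U hinj ↥P
    rw [map_zero]
    ext φ
    exact congrArg (fun t => t (φ.comp f)) hm
  · intro Φ
    obtain ⟨p, hp⟩ := evl_surj_of_proj R S U hsurj ↥P (Φ.comp (precompS R S U f))
    have hgp : g p = 0 := by
      apply hN.1 (by omega)
      rw [map_zero]
      ext φ
      have h1 := congrArg (fun t => t (φ.comp g)) hp
      have h2 : (φ.comp g).comp f = 0 := by
        ext m
        have : f m ∈ LinearMap.ker g := h ▸ ⟨m, rfl⟩
        simp [LinearMap.mem_ker.1 this]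
      have h3 : precompS R S U f (φ.comp g) = 0 := h2
      simp only [LinearMap.comp_apply, h3, map_zero] at h1
      exact h1
    have hpr : p ∈ LinearMap.range f := by rw [h]; exact hgp
    obtain ⟨m, rfl⟩ := hpr
    refine ⟨m, ?_⟩
    have hle : LinearMap.range (precompS R S U f) ≤ LinearMap.ker (evl R S U ↥M m - Φ) := by
      rintro _ ⟨φ, rfl⟩
      have h1 := congrArg (fun t => t φ) hp
      rw [LinearMap.mem_ker, LinearMap.sub_apply, sub_eq_zero]
      exact h1
    have h0 := hE0 (by omega) (Submodule.liftQ _ _ hle)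
    rw [← sub_eq_zero]
    ext φ
    exact congrArg (fun t => t (Submodule.Quotient.mk φ)) h0
  · let π := precompS R S U f
    let K := LinearMap.range π
    refine les_mid S (A := ModuleCat.of S ↥K) (B := ModuleCat.of S (↥M →ₗ[R] U))
      (C := ModuleCat.of S ((↥M →ₗ[R] U) ⧸ K)) K.subtype K.mkQ
      (by rw [Submodule.range_subtype, Submodule.ker_mkQ])
      (Submodule.subtype_injective _) (Submodule.mkQ_surjective _) j ?_
      (hE j hj (by omega)) x
    obtain ⟨j, rfl⟩ : ∃ j', j = j' + 1 := ⟨j - 1, by omega⟩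
    refine les_third S (A := ModuleCat.of S (↥N →ₗ[R] U)) (B := ModuleCat.of S (↥P →ₗ[R] U))
      (C := ModuleCat.of S ↥K) (precompS R S U g) π.rangeRestrict
      (by
        rw [LinearMap.ker_rangeRestrict]
        apply le_antisymm
        · rintro _ ⟨φ, rfl⟩
          rw [LinearMap.mem_ker]
          ext m
          have : f m ∈ LinearMap.ker g := h ▸ ⟨m, rfl⟩
          change φ (g (f m)) = 0
          simp [LinearMap.mem_ker.1 this]
        · intro φ hφ
          have hle : LinearMap.ker g ≤ LinearMap.ker φ := by
            rw [← h]
            rintro _ ⟨m, rfl⟩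
            exact congrArg (fun t => t m) (LinearMap.mem_ker.1 hφ)
          refine ⟨((LinearMap.ker g).liftQ _ hle).comp
            (g.quotKerEquivOfSurjective hg).symm.toLinearMap, ?_⟩
          ext p
          have : (g.quotKerEquivOfSurjective hg).symm (g p) = Submodule.Quotient.mk p := by
            rw [LinearEquiv.symm_apply_eq]; rfl
          change (LinearMap.ker g).liftQ _ hle ((g.quotKerEquivOfSurjective hg).symm (g p)) = _
          rw [this]; rfl)
      (by
        intro φ ψ hh
        ext n
        obtain ⟨p, rfl⟩ := hg n
        exact congrArg (fun t => t p) hh) π.surjective_rangeRestrict j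
      (ext_dual_proj R S U hU ↥P (j + 1) hj) ?_
      (fun hj0 => hN.2.2 j hj0 (by omega))
    rintro rfl φ
    obtain ⟨n, hn⟩ := hN.2.1 (by omega) φ
    obtain ⟨p, rfl⟩ := hg n
    refine ⟨evl R S U ↥P p, ?_⟩
    ext ψ
    exact congrArg (fun t => t ψ) hn

lemma ext_zero_of_equiv {A B : ModuleCat.{0} S} (e : ↥A ≃ₗ[S] ↥B) {Y : ModuleCat.{0} S} (j : ℕ)
    (h : ∀ x : Ext B Y j, x = 0) (x : Ext A Y j) : x = 0 := by
  rw [← Ext.mk₀_id_comp x, ← e.toModuleIso.hom_inv_id, ← Ext.mk₀_comp_mk₀_assoc,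
    h ((Ext.mk₀ _).comp x _), Ext.comp_zero]

lemma exists_shift (k : ℕ) : ∀ M : ModuleCat.{0} R, Module.Finite R ↥M → IsSyzygy R k M →
    ∃ (X : ModuleCat.{0} R) (e : Ext X M k), Module.Finite R ↥X ∧ Shift X M k e := by
  induction k with
  | zero => exact fun M hM _ => ⟨M, _, hM, shift_zero M⟩
  | succ k ih =>
    rintro M hM ⟨P, hP, hP', f, hf, h⟩
    obtain ⟨X, e, hX, he⟩ := ih _ inferInstance h
    obtain ⟨e', he', -⟩ := shift_succ he f (LinearMap.range f).mkQ
      (Submodule.ker_mkQ _).symm hf (Submodule.mkQ_surjective _)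
    exact ⟨X, e', hX, he'⟩

lemma TF_of_syzygy (hinj : ∀ a : R, (∀ u : U, a • u = 0) → a = 0)
    (hsurj : ∀ φ : U →ₗ[S] U, ∃ a : R, ∀ u : U, φ u = a • u)
    (hU : ∀ j, 1 ≤ j → ∀ x : Ext (ModuleCat.of S U) (ModuleCat.of S U) j, x = 0)
    (k : ℕ) (hgrade : ∀ M : ModuleCat.{0} R, Module.Finite R ↥M → ∀ i, 1 ≤ i → i ≤ k - 1 →
      gradeGE S R U (ModuleCat.of S (ExtU R S U M (i + 1))) i) :
    ∀ M : ModuleCat.{0} R, Module.Finite R ↥M → IsSyzygy R k M → TF R S U k M := by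
  induction k with
  | zero => exact fun M _ _ => ⟨fun h => by omega, fun h => by omega, fun j _ h => by omega⟩
  | succ k ih =>
    rintro M hM ⟨P, hP, hP', f, hf, h⟩
    have hN := ih (fun M hM i hi hik => hgrade M hM i hi (by omega)) _ inferInstance h
    obtain ⟨X, e, hX, he⟩ := exists_shift R k _ inferInstance h
    obtain ⟨E⟩ := ext_quot_equiv S U he f (LinearMap.range f).mkQ
      (Submodule.ker_mkQ _).symm hf (Submodule.mkQ_surjective _)
    refine TF_step R S U hinj hsurj hU f (LinearMap.range f).mkQ
      (Submodule.ker_mkQ _).symm hf (Submodule.mkQ_surjective _) k hN ?_ ?_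
    · intro hk φ
      have h0 : Subsingleton (ExtU R S U X (k + 1) →ₗ[S] U) :=
        hgrade X hX k hk (by omega) 0 (by omega)
      have : φ.comp E.symm.toLinearMap = 0 := Subsingleton.elim _ _
      ext y
      have h1 := congrArg (fun t => t (E (Submodule.Quotient.mk y))) this
      simpa using h1
    · intro j hj hjk x
      refine ext_zero_of_equiv S (B := ModuleCat.of S (ExtU R S U X (k + 1))) E j ?_ x
      obtain ⟨j, rfl⟩ : ∃ j', j = j' + 1 := ⟨j - 1, by omega⟩
      exact ext_zero_of_extVanish R U _ j (hgrade X hX k (by omega) (by omega) (j + 1) hjk)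

end Aux3

section Statement

variable (Λ Γ : Type) [Ring Λ] [Ring Γ]
  [IsNoetherianRing Λ] [IsNoetherianRing Λᵐᵒᵖ]
  [IsNoetherianRing Γ] [IsNoetherianRing Γᵐᵒᵖ]
variable (U : Type) [AddCommGroup U] [Module Λ U] [Module Γᵐᵒᵖ U]
  [SMulCommClass Λ Γᵐᵒᵖ U] [SMulCommClass Γᵐᵒᵖ Λ U]
  [Module.Finite Λ U] [Module.Finite Γᵐᵒᵖ U]

/-- **Lemma 3.2.** If `grade_U Ext^{i+1}_Λ(M,U) ≥ i` for every `M ∈ mod Λ` and every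
`1 ≤ i ≤ k-1`, then every `k`-syzygy module in `mod Λ` is a `U`-`k`-syzygy module. -/
theorem syzygy_is_U_syzygy (k : ℕ)
    (hfb : FaithfullyBalanced Λ Γ U) (hso : SelfOrthogonal Λ Γ U)
    (hgrade : ∀ M : ModuleCat.{0} Λ, Module.Finite Λ ↥M → ∀ i, 1 ≤ i → i ≤ k - 1 →
      gradeGE Γᵐᵒᵖ Λ U (ModuleCat.of Γᵐᵒᵖ (ExtU Λ Γᵐᵒᵖ U M (i + 1))) i) :
    ∀ M : ModuleCat.{0} Λ, Module.Finite Λ ↥M → IsSyzygy Λ k M → IsUSyzygy Λ U k M := by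
  intro M hM hs
  refine TF.usyz Λ Γᵐᵒᵖ U (TF_of_syzygy Λ Γᵐᵒᵖ U ?_ ?_ ?_ k hgrade M hM hs)
  · intro a ha
    apply hfb.1.1
    ext u
    simpa [lmul] using ha u
  · intro φ
    obtain ⟨a, rfl⟩ := hfb.1.2 φ
    exact ⟨a, fun u => rfl⟩
  · intro j hj x
    obtain ⟨j, rfl⟩ : ∃ j', j = j' + 1 := ⟨j - 1, by omega⟩
    exact ext_zero_of_extVanish Λ U _ j (hso.2 (j + 1) hj) x


end Statement

end GorPaper
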